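/- (Super-diffusion before the transition threshold.) Write λ₂⁽¹⁾ = λ₂(L₁) and λ₂⁽²⁾ = λ₂(L₂), and assume λ₂⁽²⁾ > 0, n·λ₂⁽²⁾ < m·λ₂⁽¹⁾ (i.e. λ₂⁽²⁾/m < λ₂⁽¹⁾/n), and λ₂⁽¹⁾ < (1 + n/m)·λ₂⁽²⁾, so that the super-diffusion condition λ₂⁽²⁾/m < λ₂⁽¹⁾/n < (1/n + 1/m)·λ₂⁽²⁾ holds. Then at the threshold budget c* = n·λ₂⁽²⁾, the uniform all-pairs interconnection gives λ₂(L(W_{c*})) = (1 + n/m)·λ₂⁽²⁾ > max{λ₂⁽¹⁾, λ₂⁽²⁾}; i.e. the interconnected network diffuses strictly faster than either layer in isolation. -/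

import Mathlib

open Matrix

noncomputable def supraLap {n m : ℕ} (L₁ : Matrix (Fin n) (Fin n) ℝ)
    (L₂ : Matrix (Fin m) (Fin m) ℝ) (W : Matrix (Fin n) (Fin m) ℝ) :
    Matrix (Fin n ⊕ Fin m) (Fin n ⊕ Fin m) ℝ :=
  Matrix.fromBlocks (L₁ + Matrix.diagonal (W *ᵥ fun _ => 1)) (-W)
    (-Wᵀ) (L₂ + Matrix.diagonal (Wᵀ *ᵥ fun _ => 1))

noncomputable def lam2 {K : Type*} [Fintype K] (M : Matrix K K ℝ) : ℝ :=
  sInf {r : ℝ | ∃ v : K → ℝ, v ≠ 0 ∧ (∑ i, v i) = 0 ∧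
    r = (v ⬝ᵥ (M *ᵥ v)) / (∑ i, (v i) ^ 2)}

theorem lam2_le_of {K : Type*} [Fintype K] (M : Matrix K K ℝ) (hM : ∀ v : K → ℝ, 0 ≤ v ⬝ᵥ (M *ᵥ v))
    (v : K → ℝ) (hv : v ≠ 0) (hs : (∑ i, v i) = 0) :
    lam2 M ≤ (v ⬝ᵥ (M *ᵥ v)) / (∑ i, (v i) ^ 2) := by
  apply csInf_le
  · refine ⟨0, ?_⟩
    rintro r ⟨u, -, -, rfl⟩
    exact div_nonneg (hM u) (Finset.sum_nonneg fun i _ => sq_nonneg _)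
  · exact ⟨v, hv, hs, rfl⟩

theorem sumsq_pos {K : Type*} [Fintype K] (v : K → ℝ) (hv : v ≠ 0) : 0 < ∑ i, (v i) ^ 2 := by
  obtain ⟨i, hi⟩ := Function.ne_iff.mp hv
  exact Finset.sum_pos' (fun i _ => sq_nonneg _) ⟨i, Finset.mem_univ _, by
    have : v i ≠ 0 := hi
    positivity⟩

theorem layer_bound {n : ℕ} (hn : 2 ≤ n) (L : Matrix (Fin n) (Fin n) ℝ) (hL : L.PosSemidef)
    (h1 : L *ᵥ (fun _ => 1) = 0) (x : Fin n → ℝ) :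
    lam2 L * (∑ i, (x i) ^ 2 - (∑ i, x i) ^ 2 / n) ≤ x ⬝ᵥ (L *ᵥ x) := by
  have hn0 : (n : ℝ) ≠ 0 := by positivity
  have hpsd : ∀ v : Fin n → ℝ, 0 ≤ v ⬝ᵥ (L *ᵥ v) := fun v => by
    simpa using hL.dotProduct_mulVec_nonneg v
  have hsym : Lᵀ = L := by
    have := hL.isHermitian
    simpa [Matrix.IsHermitian, Matrix.conjTranspose_eq_transpose_of_trivial] using this
  set a : ℝ := (∑ i, x i) / n with ha
  set p : Fin n → ℝ := x - a • (fun _ => 1) with hp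
  have hS : ∑ i, x i = a * n := by rw [ha]; field_simp
  have hps : ∑ i, p i = 0 := by
    simp [hp, Finset.sum_sub_distrib, hS]; ring
  have hpp : ∑ i, (p i) ^ 2 = ∑ i, (x i) ^ 2 - (∑ i, x i) ^ 2 / n := by
    have : ∀ i, (p i) ^ 2 = (x i) ^ 2 - 2 * a * x i + a ^ 2 := fun i => by simp [hp]; ring
    simp only [this, Finset.sum_add_distrib, Finset.sum_sub_distrib, ← Finset.mul_sum, hS]
    simp
    field_simp
    ring
  have hq : x ⬝ᵥ (L *ᵥ x) = p ⬝ᵥ (L *ᵥ p) := by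
    have e : L *ᵥ p = L *ᵥ x := by
      rw [hp, Matrix.mulVec_sub, Matrix.mulVec_smul, h1]; simp
    rw [e, hp, sub_dotProduct, smul_dotProduct, Matrix.dotProduct_mulVec (fun _ => (1:ℝ)),
      ← Matrix.mulVec_transpose, hsym, h1]
    simp
  rw [hq, ← hpp]
  by_cases hz : p = 0
  · simp [hz]
  · have := lam2_le_of L hpsd p hz hps
    rwa [le_div_iff₀ (sumsq_pos p hz)] at this

theorem supra_form {n m : ℕ} (L₁ : Matrix (Fin n) (Fin n) ℝ) (L₂ : Matrix (Fin m) (Fin m) ℝ) (w : ℝ)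
    (v : Fin n ⊕ Fin m → ℝ) :
    v ⬝ᵥ (supraLap L₁ L₂ (Matrix.of fun _ _ => w) *ᵥ v) =
      (v ∘ Sum.inl) ⬝ᵥ (L₁ *ᵥ (v ∘ Sum.inl)) + (v ∘ Sum.inr) ⬝ᵥ (L₂ *ᵥ (v ∘ Sum.inr))
      + w * m * ∑ i, (v (Sum.inl i)) ^ 2 + w * n * ∑ i, (v (Sum.inr i)) ^ 2
      - 2 * w * (∑ i, v (Sum.inl i)) * (∑ i, v (Sum.inr i)) := by
  have e1 : (Matrix.of fun (_ : Fin n) (_ : Fin m) => w) *ᵥ (v ∘ Sum.inr)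
      = fun _ => w * ∑ i, v (Sum.inr i) := by
    ext i; simp [Matrix.mulVec, dotProduct, Finset.mul_sum]
  have e2 : (Matrix.of fun (_ : Fin n) (_ : Fin m) => w)ᵀ *ᵥ (v ∘ Sum.inl)
      = fun _ => w * ∑ i, v (Sum.inl i) := by
    ext i; simp [Matrix.mulVec, dotProduct, Finset.mul_sum]
  have e3 : (Matrix.of fun (_ : Fin n) (_ : Fin m) => w) *ᵥ (fun _ => 1)
      = fun _ => w * m := by
    ext i; simp [Matrix.mulVec, dotProduct]; ring
  have e4 : (Matrix.of fun (_ : Fin n) (_ : Fin m) => w)ᵀ *ᵥ (fun _ => 1)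
      = fun _ => w * n := by
    ext i; simp [Matrix.mulVec, dotProduct]; ring
  rw [supraLap, Matrix.fromBlocks_mulVec, Matrix.neg_mulVec, Matrix.neg_mulVec, e1, e2, e3, e4,
    Matrix.add_mulVec, Matrix.add_mulVec]
  have d1 : ∀ i, (Matrix.diagonal (fun _ : Fin n => w * m) *ᵥ (v ∘ Sum.inl)) i
      = w * m * v (Sum.inl i) := fun i => by simp [Matrix.mulVec_diagonal]
  have d2 : ∀ i, (Matrix.diagonal (fun _ : Fin m => w * n) *ᵥ (v ∘ Sum.inr)) i
      = w * n * v (Sum.inr i) := fun i => by simp [Matrix.mulVec_diagonal]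
  simp only [dotProduct, Fintype.sum_sum_type, Sum.elim_inl, Sum.elim_inr, Pi.add_apply,
    Pi.neg_apply, d1, d2, mul_add, Finset.sum_add_distrib, mul_neg, Finset.sum_neg_distrib,
    ← Finset.sum_mul, Function.comp]
  have s1 : ∑ i, v (Sum.inl i) * (w * m * v (Sum.inl i)) = w * m * ∑ i, (v (Sum.inl i)) ^ 2 := by
    rw [Finset.mul_sum]; exact Finset.sum_congr rfl fun i _ => by ring
  have s2 : ∑ i, v (Sum.inr i) * (w * n * v (Sum.inr i)) = w * n * ∑ i, (v (Sum.inr i)) ^ 2 := by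
    rw [Finset.mul_sum]; exact Finset.sum_congr rfl fun i _ => by ring
  rw [s1, s2]
  ring

theorem stmt_16 {n m : ℕ} (hn : 2 ≤ n) (hm : 2 ≤ m)
    (L₁ : Matrix (Fin n) (Fin n) ℝ) (L₂ : Matrix (Fin m) (Fin m) ℝ)
    (hL₁ : L₁.PosSemidef) (hL₂ : L₂.PosSemidef)
    (hL₁1 : L₁ *ᵥ (fun _ => 1) = 0) (hL₂1 : L₂ *ᵥ (fun _ => 1) = 0)
    (hpos : 0 < lam2 L₂)
    (hlt : (n : ℝ) * lam2 L₂ < (m : ℝ) * lam2 L₁)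
    (hub : lam2 L₁ < (1 + (n : ℝ) / m) * lam2 L₂) :
    let cstar : ℝ := (n : ℝ) * lam2 L₂
    lam2 (supraLap L₁ L₂ (Matrix.of fun _ _ => cstar / ((n : ℝ) * m))) =
        (1 + (n : ℝ) / m) * lam2 L₂ ∧
    (1 + (n : ℝ) / m) * lam2 L₂ > max (lam2 L₁) (lam2 L₂) := by
  intro cstar
  have hn0 : (0 : ℝ) < n := by positivity
  have hm0 : (0 : ℝ) < m := by positivity
  have hw : cstar / ((n : ℝ) * m) = lam2 L₂ / m := by
    simp only [cstar]; field_simp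
  rw [hw]
  have hb1 := layer_bound hn L₁ hL₁ hL₁1
  have hb2 := layer_bound hm L₂ hL₂ hL₂1
  set l2 := lam2 L₂ with hl2
  set l1 := lam2 L₁ with hl1
  refine ⟨?_, ?_⟩
  · have key : ∀ v : Fin n ⊕ Fin m → ℝ, (∑ i, v i) = 0 →
        (1 + (n : ℝ) / m) * l2 * (∑ i, (v i) ^ 2) ≤
          v ⬝ᵥ (supraLap L₁ L₂ (Matrix.of fun _ _ => l2 / m) *ᵥ v) := by
      intro v hv
      rw [supra_form]
      have h1 := hb1 (v ∘ Sum.inl)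
      have h2 := hb2 (v ∘ Sum.inr)
      rw [Fintype.sum_sum_type] at hv ⊢
      simp only [Function.comp_apply] at h1 h2
      have hcs : 0 ≤ ∑ i, (v (Sum.inl i)) ^ 2 - (∑ i, v (Sum.inl i)) ^ 2 / n := by
        have := sq_sum_le_card_mul_sum_sq (s := Finset.univ) (f := fun i : Fin n => v (Sum.inl i))
        rw [sub_nonneg, div_le_iff₀ hn0]
        simp at this
        linarith
      have h3 : n / m * l2 ≤ l1 := by
        rw [div_mul_eq_mul_div, div_le_iff₀ hm0]; linarith
      have h4 := mul_le_mul_of_nonneg_right h3 hcs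
      have hT : ∑ i, v (Sum.inr i) = - ∑ i, v (Sum.inl i) := by linarith
      rw [hT] at h2 ⊢
      refine le_trans (le_of_eq ?_) (add_le_add_left (add_le_add_left (add_le_add_left
        (add_le_add (h4.trans h1) h2) _) _) _)
      field_simp
      ring
    have hne : (Sum.elim (fun _ => (m : ℝ)) (fun _ => -(n : ℝ)) : Fin n ⊕ Fin m → ℝ) ≠ 0 := by
      intro h
      have := congrFun h (Sum.inl ⟨0, by omega⟩)
      simp at this
      omega
    have hmem : (1 + (n : ℝ) / m) * l2 ∈ {r : ℝ | ∃ v : Fin n ⊕ Fin m → ℝ, v ≠ 0 ∧ (∑ i, v i) = 0 ∧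
        r = (v ⬝ᵥ (supraLap L₁ L₂ (Matrix.of fun _ _ => l2 / m) *ᵥ v)) / (∑ i, (v i) ^ 2)} := by
      refine ⟨_, hne, ?_, ?_⟩
      · simp; ring
      · rw [eq_div_iff (sumsq_pos _ hne).ne', supra_form]
        have c1 : (fun _ : Fin n => (m : ℝ)) = (m : ℝ) • (fun _ => 1) := by ext; simp
        have c2 : (fun _ : Fin m => -(n : ℝ)) = (-n : ℝ) • (fun _ => 1) := by ext; simp
        rw [Sum.elim_comp_inl, Sum.elim_comp_inr, c1, c2, Matrix.mulVec_smul, Matrix.mulVec_smul,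
          hL₁1, hL₂1]
        simp
        field_simp
        ring
    refine IsLeast.csInf_eq ⟨hmem, ?_⟩
    rintro r ⟨v, hv, hs, rfl⟩
    rw [le_div_iff₀ (sumsq_pos v hv)]
    exact key v hs
  · refine max_lt hub ?_
    have : 0 < (n : ℝ) / m * l2 := by positivity
    linarith
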